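/- arXiv:2602.12555 — 5 statements merged into one kernel-verified Lean document; each statement's English description precedes it below -/
import Mathlib

section
/- Let ∂ be a link-graded derivation on A, let ε : A → k be a k-algebra homomorphism with ε ∘ ∂ = 0, let d : P → kˣ, and let ε' : A → k be the k-algebra homomorphism determined on generators by ε'(ι x) = d(c x)·d(r x)⁻¹·ε(ι x) for all x ∈ S. Then ε' ∘ ∂ = 0. (That is, dilating an augmentation of a link-graded dga yields an augmentation.) -/
/-- The monomial `w y := ι y₁ * ⋯ * ι y_m ∈ FreeAlgebra k S` associated to a list `y`,
with `w [] = 1`. -/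
def FreeAlgebra.word (k : Type*) [CommSemiring k] {S : Type*} (y : List S) :
    FreeAlgebra k S :=
  (y.map (FreeAlgebra.ι k)).prod

/-- A list `[y₁, …, y_m]` is composable (w.r.t. `c r : S → P`) if `c (y_l) = r (y_{l+1})`
for all `1 ≤ l < m`; the empty list is composable. -/
def Composable {S P : Type*} (c r : S → P) (y : List S) : Prop :=
  List.Chain' (fun a b => c a = r b) y

/-- The set of monomials `w y` over composable lists `y` whose endpoints are
`(c x, r x)`: for nonempty `y` this means `c (y.getLast) = c x` and `r (y.head) = r x`;
the empty list has endpoints `(p, p)` for every `p`, hence qualifies iff `c x = r x`. -/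
def linkMonomials (k : Type*) [CommSemiring k] {S P : Type*} (c r : S → P) (x : S) :
    Set (FreeAlgebra k S) :=
  {a | ∃ y : List S, Composable c r y ∧
    ((∃ h : y ≠ [], c (y.getLast h) = c x ∧ r (y.head h) = r x) ∨
      (y = [] ∧ c x = r x)) ∧
    a = FreeAlgebra.word k y}

/-- On a nonempty composable word, the dilation factors of the letters telescope. -/
theorem dilation_word_of_composable {k S P : Type*} [Field k] {c r : S → P}
    {ε ε' : FreeAlgebra k S →ₐ[k] k} {d : P → kˣ}
    (hε' : ∀ x : S, ε' (FreeAlgebra.ι k x) =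
      (d (c x) : k) * ((d (r x) : k))⁻¹ * ε (FreeAlgebra.ι k x))
    {y : List S} (hy : Composable c r y) (hne : y ≠ []) :
    ε' (FreeAlgebra.word k y) =
      (d (c (y.getLast hne)) : k) * ((d (r (y.head hne)) : k))⁻¹ *
        ε (FreeAlgebra.word k y) := by
  induction y with
  | nil => exact absurd rfl hne
  | cons a l ih =>
    cases l with
    | nil => simp [FreeAlgebra.word, hε']
    | cons b l =>
      obtain ⟨hab, hl⟩ := List.isChain_cons_cons.mp hy
      have hword : FreeAlgebra.word k (a :: b :: l) =
          FreeAlgebra.ι k a * FreeAlgebra.word k (b :: l) := by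
        simp [FreeAlgebra.word]
      have hb : (d (r b) : k) ≠ 0 := (d (r b)).ne_zero
      rw [hword, map_mul, map_mul, hε', ih hl (List.cons_ne_nil b l), hab,
        List.getLast_cons (List.cons_ne_nil b l)]
      simp only [List.head_cons]
      field_simp

/-- On the span of the monomials linked like `x`, the dilation acts by the factor of `x`. -/
theorem dilation_apply_of_mem_span_linkMonomials {k S P : Type*} [Field k] {c r : S → P}
    {ε ε' : FreeAlgebra k S →ₐ[k] k} {d : P → kˣ}
    (hε' : ∀ x : S, ε' (FreeAlgebra.ι k x) =
      (d (c x) : k) * ((d (r x) : k))⁻¹ * ε (FreeAlgebra.ι k x))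
    {x : S} {a : FreeAlgebra k S} (ha : a ∈ Submodule.span k (linkMonomials k c r x)) :
    ε' a = (d (c x) : k) * ((d (r x) : k))⁻¹ * ε a := by
  induction ha using Submodule.span_induction with
  | mem a ha =>
    obtain ⟨y, hy, ⟨hne, hc, hr⟩ | ⟨rfl, hx⟩, rfl⟩ := ha
    · rw [dilation_word_of_composable hε' hy hne, hc, hr]
    · simp [FreeAlgebra.word, hx]
  | zero => simp
  | add a b _ _ iha ihb => rw [map_add, map_add, iha, ihb, mul_add]
  | smul t a _ iha =>
    rw [map_smul, map_smul, iha, smul_eq_mul, smul_eq_mul, mul_left_comm]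

/-- Let `D` be a link-graded derivation on `A := FreeAlgebra k S`, let
`ε : A → k` be a `k`-algebra homomorphism with `ε ∘ D = 0`, let `d : P → kˣ`, and let
`ε' : A → k` be the `k`-algebra homomorphism determined on generators by
`ε' (ι x) = d (c x) * (d (r x))⁻¹ * ε (ι x)`. Then `ε' ∘ D = 0`; i.e. dilating an
augmentation of a link-graded dga yields an augmentation. -/
theorem dilation_of_augmentation_is_augmentation
    (k : Type*) [Field k] (S P : Type*) (c r : S → P)
    (D : FreeAlgebra k S →ₗ[k] FreeAlgebra k S)
    (hLeibniz : ∀ a b : FreeAlgebra k S, D (a * b) = D a * b + a * D b)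
    (hgraded : ∀ x : S,
      D (FreeAlgebra.ι k x) ∈ Submodule.span k (linkMonomials k c r x))
    (ε ε' : FreeAlgebra k S →ₐ[k] k)
    (hε : ∀ a : FreeAlgebra k S, ε (D a) = 0)
    (d : P → kˣ)
    (hε' : ∀ x : S, ε' (FreeAlgebra.ι k x) =
      (d (c x) : k) * ((d (r x) : k))⁻¹ * ε (FreeAlgebra.ι k x)) :
    ∀ a : FreeAlgebra k S, ε' (D a) = 0 := by
  intro a
  induction a using FreeAlgebra.induction with
  | grade0 t =>
    have hone : D 1 = 0 := by simpa using hLeibniz 1 1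
    rw [Algebra.algebraMap_eq_smul_one, map_smul, hone, smul_zero, map_zero]
  | grade1 x =>
    rw [dilation_apply_of_mem_span_linkMonomials hε' (hgraded x), hε, mul_zero]
  | mul a b iha ihb => simp [hLeibniz, iha, ihb]
  | add a b iha ihb => simp [iha, ihb]
end

section
/- Assume char k = 2. Let ∂ be a link-graded derivation on A and let ε₁, ε₂, ε₃ : A → k be k-algebra homomorphisms. Suppose K is a dga homotopy from ε₁ to ε₂, suppose d : P → kˣ, and suppose ε₃(ι x) = d(c x)·d(r x)⁻¹·ε₂(ι x) for all x ∈ S. Let K'' be the unique (ε₁,ε₃)-twisted derivation with K''(ι x) = d(c x)·K(ι x) for all x ∈ S. Then K'' is a dilated augmentation homotopy from ε₁ to ε₃ with dilating tuple d, i.e., d(c x)·ε₁(ι x) + d(r x)·ε₃(ι x) = K''(∂(ι x)) for all x ∈ S. (The composition of a dga homotopy followed by a dilation is a dilated augmentation homotopy.) -/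
theorem FreeAlgebra.word_nil (k : Type*) [CommSemiring k] {S : Type*} :
    FreeAlgebra.word k ([] : List S) = 1 := rfl

theorem FreeAlgebra.word_cons (k : Type*) [CommSemiring k] {S : Type*} (a : S) (y : List S) :
    FreeAlgebra.word k (a :: y) = FreeAlgebra.ι k a * FreeAlgebra.word k y := by
  simp [FreeAlgebra.word]

/-- A twisted derivation vanishes at `1`. -/
theorem twistedDerivation_one {k A : Type*} [Field k] [Ring A] [Algebra k A]
    {ε₁ ε₂ : A →ₐ[k] k} {K : A →ₗ[k] k}
    (hK : ∀ a b : A, K (a * b) = K a * ε₂ b + ε₁ a * K b) : K 1 = 0 := by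
  simpa using hK 1 1

/-- Dilating an algebra homomorphism on generators rescales its value on a composable word by
the ratio of the dilating tuple at the endpoints of the word. -/
theorem dilation_word {k S P : Type*} [Field k] {c r : S → P}
    {ε₂ ε₃ : FreeAlgebra k S →ₐ[k] k} {d : P → kˣ}
    (hε₃ : ∀ x : S, ε₃ (FreeAlgebra.ι k x) =
      (d (c x) : k) * ((d (r x) : k))⁻¹ * ε₂ (FreeAlgebra.ι k x))
    (a : S) (y : List S) (hy : Composable c r (a :: y)) :
    ε₃ (FreeAlgebra.word k (a :: y)) =
      (d (c ((a :: y).getLast (List.cons_ne_nil a y))) : k) * ((d (r a) : k))⁻¹ *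
        ε₂ (FreeAlgebra.word k (a :: y)) := by
  induction y generalizing a with
  | nil => simpa [FreeAlgebra.word] using hε₃ a
  | cons b t ih =>
    obtain ⟨hab, ht⟩ := List.isChain_cons_cons.mp hy
    have hb : (d (r b) : k) ≠ 0 := (d (r b)).ne_zero
    rw [FreeAlgebra.word_cons, map_mul, map_mul, ih b ht, hε₃ a, hab,
      List.getLast_cons (List.cons_ne_nil b t)]
    field_simp

/-- The twisted derivation obtained by rescaling `K` on generators agrees, on a composable word,
with `K` rescaled by the dilating tuple at the column endpoint of the word. -/
theorem dilated_twistedDerivation_word {k S P : Type*} [Field k] {c r : S → P}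
    {ε₁ ε₂ ε₃ : FreeAlgebra k S →ₐ[k] k} {K K'' : FreeAlgebra k S →ₗ[k] k} {d : P → kˣ}
    (hK : ∀ a b : FreeAlgebra k S, K (a * b) = K a * ε₂ b + ε₁ a * K b)
    (hε₃ : ∀ x : S, ε₃ (FreeAlgebra.ι k x) =
      (d (c x) : k) * ((d (r x) : k))⁻¹ * ε₂ (FreeAlgebra.ι k x))
    (hK'' : ∀ a b : FreeAlgebra k S, K'' (a * b) = K'' a * ε₃ b + ε₁ a * K'' b)
    (hgen : ∀ x : S, K'' (FreeAlgebra.ι k x) = (d (c x) : k) * K (FreeAlgebra.ι k x))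
    (a : S) (y : List S) (hy : Composable c r (a :: y)) :
    K'' (FreeAlgebra.word k (a :: y)) =
      (d (c ((a :: y).getLast (List.cons_ne_nil a y))) : k) *
        K (FreeAlgebra.word k (a :: y)) := by
  induction y generalizing a with
  | nil => simpa [FreeAlgebra.word] using hgen a
  | cons b t ih =>
    obtain ⟨hab, ht⟩ := List.isChain_cons_cons.mp hy
    have hb : (d (r b) : k) ≠ 0 := (d (r b)).ne_zero
    rw [FreeAlgebra.word_cons, hK, hK'', ih b ht, dilation_word hε₃ b t ht, hgen a, hab,
      List.getLast_cons (List.cons_ne_nil b t)]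
    field_simp

/-- `char k = 2`. Let `D` be a link-graded derivation on
`A := FreeAlgebra k S`, let `ε₁ ε₂ ε₃ : A → k` be `k`-algebra homomorphisms, let `K` be a
dga homotopy from `ε₁` to `ε₂` (an `(ε₁,ε₂)`-twisted derivation with
`ε₁ (ι x) + ε₂ (ι x) = K (D (ι x))`), let `d : P → kˣ`, and suppose
`ε₃ (ι x) = d (c x) * (d (r x))⁻¹ * ε₂ (ι x)` for all `x`. Let `K''` be the unique
`(ε₁,ε₃)`-twisted derivation with `K'' (ι x) = d (c x) * K (ι x)`. Then `K''` is a dilated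
augmentation homotopy from `ε₁` to `ε₃` with dilating tuple `d`:
`d (c x) * ε₁ (ι x) + d (r x) * ε₃ (ι x) = K'' (D (ι x))` for all `x`. -/
theorem dga_homotopy_then_dilation
    (k : Type*) [Field k] [CharP k 2] (S P : Type*) (c r : S → P)
    (D : FreeAlgebra k S →ₗ[k] FreeAlgebra k S)
    (hLeibniz : ∀ a b : FreeAlgebra k S, D (a * b) = D a * b + a * D b)
    (hgraded : ∀ x : S,
      D (FreeAlgebra.ι k x) ∈ Submodule.span k (linkMonomials k c r x))
    (ε₁ ε₂ ε₃ : FreeAlgebra k S →ₐ[k] k)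
    (K : FreeAlgebra k S →ₗ[k] k)
    (hKtw : ∀ a b : FreeAlgebra k S, K (a * b) = K a * ε₂ b + ε₁ a * K b)
    (hKhtp : ∀ x : S,
      ε₁ (FreeAlgebra.ι k x) + ε₂ (FreeAlgebra.ι k x) = K (D (FreeAlgebra.ι k x)))
    (d : P → kˣ)
    (hε₃ : ∀ x : S, ε₃ (FreeAlgebra.ι k x) =
      (d (c x) : k) * ((d (r x) : k))⁻¹ * ε₂ (FreeAlgebra.ι k x))
    (K'' : FreeAlgebra k S →ₗ[k] k)
    (hK''tw : ∀ a b : FreeAlgebra k S, K'' (a * b) = K'' a * ε₃ b + ε₁ a * K'' b)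
    (hK''gen : ∀ x : S,
      K'' (FreeAlgebra.ι k x) = (d (c x) : k) * K (FreeAlgebra.ι k x)) :
    ∀ x : S,
      (d (c x) : k) * ε₁ (FreeAlgebra.ι k x) + (d (r x) : k) * ε₃ (FreeAlgebra.ι k x) =
        K'' (D (FreeAlgebra.ι k x)) := by
  intro x
  have key : ∀ a ∈ Submodule.span k (linkMonomials k c r x),
      K'' a = ((d (c x) : k) • K) a := by
    intro a ha
    refine LinearMap.eqOn_span (f := K'') (g := (d (c x) : k) • K) ?_ ha
    rintro _ ⟨y, hy, hend, rfl⟩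
    rcases hend with ⟨hne, hc, -⟩ | ⟨rfl, -⟩
    · cases y with
      | nil => exact absurd rfl hne
      | cons b t =>
        rw [dilated_twistedDerivation_word hKtw hε₃ hK''tw hK''gen b t hy, hc]
        rfl
    · simp [FreeAlgebra.word_nil, twistedDerivation_one hKtw, twistedDerivation_one hK''tw]
  have hr : (d (r x) : k) ≠ 0 := (d (r x)).ne_zero
  rw [key _ (hgraded x), LinearMap.smul_apply, ← hKhtp x, hε₃ x, smul_eq_mul]
  field_simp
end

section
/- Assume char k = 2. Let ∂ be a link-graded derivation on A, let ε₁, ε₃ : A → k be k-algebra homomorphisms with ε₃ ∘ ∂ = 0, let d : P → kˣ, and let K be a dilated augmentation homotopy from ε₁ to ε₃ with dilating tuple d. Define ε₂ : A → k to be the k-algebra homomorphism determined on generators by ε₂(ι x) = d(r x)·d(c x)⁻¹·ε₃(ι x), and let K' be the unique (ε₁,ε₂)-twisted derivation with K'(ι x) = d(c x)⁻¹·K(ι x) for all x ∈ S. Then: (a) ε₂ ∘ ∂ = 0; (b) K' is a dga homotopy from ε₁ to ε₂, i.e., ε₁(ι x) + ε₂(ι x) = K'(∂(ι x)) for all x ∈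 S; and (c) ε₃(ι x) = d(c x)·d(r x)⁻¹·ε₂(ι x) for all x ∈ S. (Every dilated augmentation homotopy factors as a dga homotopy followed by a dilation.) -/
namespace FreeAlgebra

theorem word_nil_s6 {k S : Type*} [CommSemiring k] : word k ([] : List S) = 1 := rfl

theorem word_cons_s6 {k S : Type*} [CommSemiring k] (x : S) (y : List S) :
    word k (x :: y) = ι k x * word k y := by
  simp [word]

end FreeAlgebra

/-- An additive map with the twisted Leibniz rule kills `1`. -/
theorem map_one_eq_zero_of_twisted {k A : Type*} [Field k] [Ring A] [Algebra k A]
    (f g : A →ₐ[k] k) (K : A →ₗ[k] k)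
    (hK : ∀ a b : A, K (a * b) = K a * g b + f a * K b) : K 1 = 0 := by
  simpa using hK 1 1

/-- On a nonempty composable word, a dilated augmentation rescales the value by the
dilation factors of the two endpoints. -/
theorem dilated_algHom_word {k S P : Type*} [Field k] (c r : S → P)
    (ε₃ : FreeAlgebra k S →ₐ[k] k) (d : P → kˣ) (ε₂ : FreeAlgebra k S →ₐ[k] k)
    (hε₂ : ∀ x : S, ε₂ (FreeAlgebra.ι k x) =
      (d (r x) : k) * ((d (c x) : k))⁻¹ * ε₃ (FreeAlgebra.ι k x))
    (x : S) (l : List S) (h : Composable c r (x :: l)) :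
    ε₂ (FreeAlgebra.word k (x :: l)) =
      (d (r x) : k) * ((d (c ((x :: l).getLast (List.cons_ne_nil x l))) : k))⁻¹ *
        ε₃ (FreeAlgebra.word k (x :: l)) := by
  induction l generalizing x with
  | nil => simp [FreeAlgebra.word_cons_s6, FreeAlgebra.word_nil_s6, hε₂]
  | cons z l ih =>
    obtain ⟨hxz, hl⟩ := List.isChain_cons_cons.mp h
    have hz : (d (r z) : k) ≠ 0 := (d (r z)).ne_zero
    rw [FreeAlgebra.word_cons_s6, map_mul, map_mul, hε₂ x, ih z hl, hxz,
      List.getLast_cons (List.cons_ne_nil z l)]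
    field_simp

/-- On a nonempty composable word, rescaling a twisted derivation on generators by the
inverse dilation factor at the column endpoint rescales its value by the same factor at the
column endpoint of the word. -/
theorem dilated_twisted_word {k S P : Type*} [Field k] (c r : S → P)
    (ε₁ ε₃ : FreeAlgebra k S →ₐ[k] k) (d : P → kˣ) (K : FreeAlgebra k S →ₗ[k] k)
    (hKtw : ∀ a b : FreeAlgebra k S, K (a * b) = K a * ε₃ b + ε₁ a * K b)
    (ε₂ : FreeAlgebra k S →ₐ[k] k)
    (hε₂ : ∀ x : S, ε₂ (FreeAlgebra.ι k x) =
      (d (r x) : k) * ((d (c x) : k))⁻¹ * ε₃ (FreeAlgebra.ι k x))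
    (K' : FreeAlgebra k S →ₗ[k] k)
    (hK'tw : ∀ a b : FreeAlgebra k S, K' (a * b) = K' a * ε₂ b + ε₁ a * K' b)
    (hK'gen : ∀ x : S,
      K' (FreeAlgebra.ι k x) = ((d (c x) : k))⁻¹ * K (FreeAlgebra.ι k x))
    (x : S) (l : List S) (h : Composable c r (x :: l)) :
    K' (FreeAlgebra.word k (x :: l)) =
      ((d (c ((x :: l).getLast (List.cons_ne_nil x l))) : k))⁻¹ *
        K (FreeAlgebra.word k (x :: l)) := by
  induction l generalizing x with
  | nil => simp [FreeAlgebra.word_cons_s6, FreeAlgebra.word_nil_s6, hK'gen]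
  | cons z l ih =>
    obtain ⟨hxz, hl⟩ := List.isChain_cons_cons.mp h
    have hz : (d (r z) : k) ≠ 0 := (d (r z)).ne_zero
    rw [FreeAlgebra.word_cons_s6, hK'tw, hKtw, hK'gen x, ih z hl,
      dilated_algHom_word c r ε₃ d ε₂ hε₂ z l hl, hxz,
      List.getLast_cons (List.cons_ne_nil z l)]
    field_simp

/-- Two linear functionals that are proportional on a set are proportional, with the same
factor, on its span. -/
theorem eq_mul_of_mem_span {k A : Type*} [Field k] [AddCommGroup A] [Module k A]
    (f g : A →ₗ[k] k) (t : k) (s : Set A) (h : ∀ a ∈ s, f a = t * g a) {a : A}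
    (ha : a ∈ Submodule.span k s) : f a = t * g a :=
  LinearMap.eqOn_span (f := f) (g := t • g) h ha

/-- A derivation of the free algebra whose values on generators are killed by an algebra
homomorphism has all its values killed by it. -/
theorem algHom_derivation_eq_zero {k S : Type*} [Field k]
    (D : FreeAlgebra k S →ₗ[k] FreeAlgebra k S)
    (hLeibniz : ∀ a b : FreeAlgebra k S, D (a * b) = D a * b + a * D b)
    (ε : FreeAlgebra k S →ₐ[k] k) (h : ∀ x, ε (D (FreeAlgebra.ι k x)) = 0)
    (a : FreeAlgebra k S) : ε (D a) = 0 := by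
  have hD : D 1 = 0 := by simpa using hLeibniz 1 1
  induction a using FreeAlgebra.induction with
  | grade0 t => simp [Algebra.algebraMap_eq_smul_one, hD]
  | grade1 x => exact h x
  | mul a b ha hb => simp [hLeibniz, ha, hb]
  | add a b ha hb => simp [ha, hb]

/-- `char k = 2`. Let `D` be a link-graded derivation on
`A := FreeAlgebra k S`, let `ε₁ ε₃ : A → k` be `k`-algebra homomorphisms with
`ε₃ ∘ D = 0`, let `d : P → kˣ`, and let `K` be a dilated augmentation homotopy from `ε₁`
to `ε₃` with dilating tuple `d` (an `(ε₁,ε₃)`-twisted derivation with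
`d (c x) * ε₁ (ι x) + d (r x) * ε₃ (ι x) = K (D (ι x))`). Define `ε₂ : A → k` on
generators by `ε₂ (ι x) = d (r x) * (d (c x))⁻¹ * ε₃ (ι x)`, and let `K'` be the unique
`(ε₁,ε₂)`-twisted derivation with `K' (ι x) = (d (c x))⁻¹ * K (ι x)`. Then
(a) `ε₂ ∘ D = 0`; (b) `K'` is a dga homotopy from `ε₁` to `ε₂`; and
(c) `ε₃ (ι x) = d (c x) * (d (r x))⁻¹ * ε₂ (ι x)` for all `x`. -/
theorem dilated_homotopy_factors
    (k : Type*) [Field k] [CharP k 2] (S P : Type*) (c r : S → P)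
    (D : FreeAlgebra k S →ₗ[k] FreeAlgebra k S)
    (hLeibniz : ∀ a b : FreeAlgebra k S, D (a * b) = D a * b + a * D b)
    (hgraded : ∀ x : S,
      D (FreeAlgebra.ι k x) ∈ Submodule.span k (linkMonomials k c r x))
    (ε₁ ε₃ : FreeAlgebra k S →ₐ[k] k)
    (hε₃aug : ∀ a : FreeAlgebra k S, ε₃ (D a) = 0)
    (d : P → kˣ)
    (K : FreeAlgebra k S →ₗ[k] k)
    (hKtw : ∀ a b : FreeAlgebra k S, K (a * b) = K a * ε₃ b + ε₁ a * K b)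
    (hKhtp : ∀ x : S,
      (d (c x) : k) * ε₁ (FreeAlgebra.ι k x) + (d (r x) : k) * ε₃ (FreeAlgebra.ι k x) =
        K (D (FreeAlgebra.ι k x)))
    (ε₂ : FreeAlgebra k S →ₐ[k] k)
    (hε₂ : ∀ x : S, ε₂ (FreeAlgebra.ι k x) =
      (d (r x) : k) * ((d (c x) : k))⁻¹ * ε₃ (FreeAlgebra.ι k x))
    (K' : FreeAlgebra k S →ₗ[k] k)
    (hK'tw : ∀ a b : FreeAlgebra k S, K' (a * b) = K' a * ε₂ b + ε₁ a * K' b)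
    (hK'gen : ∀ x : S,
      K' (FreeAlgebra.ι k x) = ((d (c x) : k))⁻¹ * K (FreeAlgebra.ι k x)) :
    (∀ a : FreeAlgebra k S, ε₂ (D a) = 0) ∧
    (∀ x : S,
      ε₁ (FreeAlgebra.ι k x) + ε₂ (FreeAlgebra.ι k x) = K' (D (FreeAlgebra.ι k x))) ∧
    (∀ x : S, ε₃ (FreeAlgebra.ι k x) =
      (d (c x) : k) * ((d (r x) : k))⁻¹ * ε₂ (FreeAlgebra.ι k x)) := by
  have hc (x : S) : (d (c x) : k) ≠ 0 := (d (c x)).ne_zero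
  have hr (x : S) : (d (r x) : k) ≠ 0 := (d (r x)).ne_zero
  refine ⟨algHom_derivation_eq_zero D hLeibniz ε₂ fun x => ?_, fun x => ?_, fun x => ?_⟩
  · have key := eq_mul_of_mem_span ε₂.toLinearMap ε₃.toLinearMap
      ((d (r x) : k) * ((d (c x) : k))⁻¹) (linkMonomials k c r x) ?_ (hgraded x)
    · simpa [hε₃aug] using key
    · rintro _ ⟨y, hy, ⟨hne, hlast, hhead⟩ | ⟨rfl, hcr⟩, rfl⟩
      · obtain ⟨z, l, rfl⟩ := List.exists_cons_of_ne_nil hne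
        rw [← hlast, ← hhead]
        exact dilated_algHom_word c r ε₃ d ε₂ hε₂ z l hy
      · simp [FreeAlgebra.word_nil_s6, hcr]
  · have key := eq_mul_of_mem_span K' K ((d (c x) : k))⁻¹ (linkMonomials k c r x) ?_
      (hgraded x)
    · rw [key, ← hKhtp, hε₂]
      have := hc x
      field_simp
    · rintro _ ⟨y, hy, ⟨hne, hlast, -⟩ | ⟨rfl, -⟩, rfl⟩
      · obtain ⟨z, l, rfl⟩ := List.exists_cons_of_ne_nil hne
        rw [← hlast]
        exact dilated_twisted_word c r ε₁ ε₃ d K hKtw ε₂ hε₂ K' hK'tw hK'gen z l hy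
      · simp [FreeAlgebra.word_nil_s6, map_one_eq_zero_of_twisted ε₁ ε₃ K hKtw,
          map_one_eq_zero_of_twisted ε₁ ε₂ K' hK'tw]
  · have := hc x
    have := hr x
    rw [hε₂]
    field_simp
end

section
/- For every α : Fin n → kˣ and κ : Fin m → k, setting A := Σ_{i} α(i)·u_i + Σ_{j} κ(j)·v_j, there exist α' : Fin n → k and κ' : Fin m → k such that, with B := Σ_{i} α'(i)·u_i + Σ_{j} κ'(j)·v_j, one has m₂(A, B) = Σ_{i} u_i; and likewise there exist α'' : Fin n → k and κ'' : Fin m → k such that, with B' := Σ_{i} α''(i)·u_i + Σ_{j} κ''(j)·v_j, one has m₂(B', A) = Σ_{i} u_i. -/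
/-- The distinguished vector `u_i := (Pi.single i 1, 0)` in `(Fin n → k) × (Fin m → k)`,
corresponding to the minimum Reeb chord of the `i`-th component. -/
def minChord (k : Type*) [Field k] (n m : ℕ) (i : Fin n) :
    (Fin n → k) × (Fin m → k) :=
  (Pi.single i 1, 0)

/-- The distinguished vector `v_j := (0, Pi.single j 1)` in `(Fin n → k) × (Fin m → k)`,
corresponding to the dual of the `j`-th degree `-1` Reeb chord (ordered by increasing
action). -/
def negChord (k : Type*) [Field k] (n m : ℕ) (j : Fin m) :
    (Fin n → k) × (Fin m → k) :=
  (0, Pi.single j 1)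

/-- If `T` acts on a family `v` upper triangularly with nonzero diagonal entries, and on a family
`u` diagonally with nonzero entries modulo the span of `v`, then the range of `T` contains
both families. -/
lemma mem_range_of_triangular {k M ι : Type*} [Field k] [AddCommGroup M] [Module k M]
    {m : ℕ} (T : M →ₗ[k] M) (u : ι → M) (v : Fin m → M) (a : ι → k) (b : Fin m → k)
    (ha : ∀ i, a i ≠ 0) (hb : ∀ j, b j ≠ 0)
    (hu : ∀ i, T (u i) - a i • u i ∈ Submodule.span k (Set.range v))
    (hv : ∀ j, T (v j) - b j • v j ∈ Submodule.span k {x | ∃ l : Fin m, j < l ∧ x = v l}) :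
    (∀ i, u i ∈ LinearMap.range T) ∧ ∀ j, v j ∈ LinearMap.range T := by
  have key : ∀ (s : k) (x : M), s ≠ 0 → T x - s • x ∈ LinearMap.range T →
      x ∈ LinearMap.range T := by
    intro s x hs hx
    have h := Submodule.sub_mem _ (LinearMap.mem_range_self T x) hx
    rw [sub_sub_cancel] at h
    exact (Submodule.smul_mem_iff _ hs).1 h
  have hvr : ∀ j, v j ∈ LinearMap.range T := by
    intro j
    induction j using WellFoundedGT.induction with
    | _ j ih =>
      refine key (b j) _ (hb j) (Submodule.span_le.2 ?_ (hv j))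
      rintro _ ⟨l, hl, rfl⟩
      exact ih l hl
  refine ⟨fun i => key (a i) _ (ha i) (Submodule.span_le.2 ?_ (hu i)), hvr⟩
  rintro _ ⟨j, rfl⟩
  exact hvr j

/-- Every vector is the combination of the distinguished vectors given by its coordinates. -/
lemma sum_minChord_add_sum_negChord {k : Type*} [Field k] {n m : ℕ}
    (x : (Fin n → k) × (Fin m → k)) :
    ∑ i, x.1 i • minChord k n m i + ∑ j, x.2 j • negChord k n m j = x := by
  ext l <;> simp [minChord, negChord, Prod.fst_sum, Prod.snd_sum, Finset.sum_apply,
    Pi.single_apply]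

/-- Left multiplication by an element with invertible `minChord` coefficients is surjective. -/
lemma surjective_mul_of_units_coeff {k : Type*} [Field k] {n m : ℕ} (c r : Fin m → Fin n)
    (m₂ : ((Fin n → k) × (Fin m → k)) →ₗ[k]
      ((Fin n → k) × (Fin m → k)) →ₗ[k] ((Fin n → k) × (Fin m → k)))
    (huu : ∀ i j : Fin n,
      m₂ (minChord k n m i) (minChord k n m j) =
        if i = j then minChord k n m i else 0)
    (hvu : ∀ (i : Fin m) (j : Fin n),
      m₂ (negChord k n m i) (minChord k n m j) =
        if j = c i then negChord k n m i else 0)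
    (huv : ∀ (i : Fin m) (j : Fin n),
      m₂ (minChord k n m j) (negChord k n m i) =
        if j = r i then negChord k n m i else 0)
    (hvv : ∀ i j : Fin m,
      m₂ (negChord k n m i) (negChord k n m j) ∈
        Submodule.span k {x | ∃ l : Fin m, max i j < l ∧ x = negChord k n m l})
    (α : Fin n → kˣ) (κ : Fin m → k) :
    Function.Surjective
      (m₂ (∑ i, (α i : k) • minChord k n m i + ∑ j, κ j • negChord k n m j)) := by
  obtain ⟨hu, hv⟩ := mem_range_of_triangular
    (m₂ (∑ i, (α i : k) • minChord k n m i + ∑ j, κ j • negChord k n m j))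
    (minChord k n m) (negChord k n m) (fun i => α i) (fun j => α (r j))
    (fun i => (α i).ne_zero) (fun j => (α (r j)).ne_zero)
    (by
      intro i
      simp only [map_add, map_sum, map_smul, LinearMap.add_apply, LinearMap.sum_apply,
        LinearMap.smul_apply, huu, hvu, smul_ite, smul_zero, Finset.sum_ite_eq',
        Finset.mem_univ, if_true, add_sub_cancel_left]
      refine Submodule.sum_mem _ fun j _ => ?_
      split_ifs
      · exact Submodule.smul_mem _ _ (Submodule.subset_span ⟨j, rfl⟩)
      · exact Submodule.zero_mem _)
    (by
      intro j
      simp only [map_add, map_sum, map_smul, LinearMap.add_apply, LinearMap.sum_apply,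
        LinearMap.smul_apply, huv, smul_ite, smul_zero, Finset.sum_ite_eq',
        Finset.mem_univ, if_true, add_sub_cancel_left]
      refine Submodule.sum_mem _ fun i _ => Submodule.smul_mem _ _
        (Submodule.span_mono ?_ (hvv i j))
      rintro _ ⟨l, hl, rfl⟩
      exact ⟨l, (le_max_right i j).trans_lt hl, rfl⟩)
  intro x
  rw [← LinearMap.mem_range, ← sum_minChord_add_sum_negChord x]
  exact Submodule.add_mem _
    (Submodule.sum_mem _ fun i _ => Submodule.smul_mem _ _ (hu i))
    (Submodule.sum_mem _ fun j _ => Submodule.smul_mem _ _ (hv j))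

/-- For every `α : Fin n → kˣ` and `κ : Fin m → k`, setting
`A := Σ_i α i • u_i + Σ_j κ j • v_j`, there exist `α' : Fin n → k` and `κ' : Fin m → k`
such that, with `B := Σ_i α' i • u_i + Σ_j κ' j • v_j`, one has `m₂ A B = Σ_i u_i`; and
likewise there exist `α''`, `κ''` giving `B'` with `m₂ B' A = Σ_i u_i`. -/
theorem exists_inverse_in_aug_plus
    (k : Type*) [Field k] (n m : ℕ) (c r : Fin m → Fin n)
    (m₂ : ((Fin n → k) × (Fin m → k)) →ₗ[k]
      ((Fin n → k) × (Fin m → k)) →ₗ[k] ((Fin n → k) × (Fin m → k)))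
    (huu : ∀ i j : Fin n,
      m₂ (minChord k n m i) (minChord k n m j) =
        if i = j then minChord k n m i else 0)
    (hvu : ∀ (i : Fin m) (j : Fin n),
      m₂ (negChord k n m i) (minChord k n m j) =
        if j = c i then negChord k n m i else 0)
    (huv : ∀ (i : Fin m) (j : Fin n),
      m₂ (minChord k n m j) (negChord k n m i) =
        if j = r i then negChord k n m i else 0)
    (hvv : ∀ i j : Fin m,
      m₂ (negChord k n m i) (negChord k n m j) ∈
        Submodule.span k {x | ∃ l : Fin m, max i j < l ∧ x = negChord k n m l}) :
    ∀ (α : Fin n → kˣ) (κ : Fin m → k),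
      (∃ (α' : Fin n → k) (κ' : Fin m → k),
        m₂ (∑ i, (α i : k) • minChord k n m i + ∑ j, κ j • negChord k n m j)
           (∑ i, α' i • minChord k n m i + ∑ j, κ' j • negChord k n m j) =
          ∑ i, minChord k n m i) ∧
      (∃ (α'' : Fin n → k) (κ'' : Fin m → k),
        m₂ (∑ i, α'' i • minChord k n m i + ∑ j, κ'' j • negChord k n m j)
           (∑ i, (α i : k) • minChord k n m i + ∑ j, κ j • negChord k n m j) =
          ∑ i, minChord k n m i) := by
  intro α κ
  constructor
  · obtain ⟨y, hy⟩ := surjective_mul_of_units_coeff c r m₂ huu hvu huv hvv α κ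
      (∑ i, minChord k n m i)
    refine ⟨y.1, y.2, ?_⟩
    rwa [sum_minChord_add_sum_negChord y]
  · obtain ⟨y, hy⟩ := surjective_mul_of_units_coeff r c m₂.flip
      (by
        intro i j
        rw [LinearMap.flip_apply, huu]
        by_cases h : i = j
        · simp [h]
        · simp [h, Ne.symm h])
      (fun i j => by rw [LinearMap.flip_apply, huv])
      (fun i j => by rw [LinearMap.flip_apply, hvu])
      (fun i j => by rw [LinearMap.flip_apply, max_comm]; exact hvv j i) α κ
      (∑ i, minChord k n m i)
    refine ⟨y.1, y.2, ?_⟩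
    rwa [sum_minChord_add_sum_negChord y]
end

section
/- Suppose A := Σ_{i} α(i)·u_i + Σ_{j} κ(j)·v_j and B := Σ_{i} α'(i)·u_i + Σ_{j} κ'(j)·v_j, where α, α' : Fin n → k and κ, κ' : Fin m → k, satisfy m₂(A, B) = Σ_{i} u_i. Then α(i)·α'(i) = 1 for every i : Fin n; in particular α(i) ≠ 0 and α'(i) ≠ 0 for all i. -/
/-- If `A := Σ_i α i • u_i + Σ_j κ j • v_j` and
`B := Σ_i α' i • u_i + Σ_j κ' j • v_j` satisfy `m₂ A B = Σ_i u_i`, then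
`α i * α' i = 1` for every `i : Fin n`; in particular `α i ≠ 0` and `α' i ≠ 0`. -/
theorem coeff_of_min_nonzero_of_invertible
    (k : Type*) [Field k] (n m : ℕ) (c r : Fin m → Fin n)
    (m₂ : ((Fin n → k) × (Fin m → k)) →ₗ[k]
      ((Fin n → k) × (Fin m → k)) →ₗ[k] ((Fin n → k) × (Fin m → k)))
    (huu : ∀ i j : Fin n,
      m₂ (minChord k n m i) (minChord k n m j) =
        if i = j then minChord k n m i else 0)
    (hvu : ∀ (i : Fin m) (j : Fin n),
      m₂ (negChord k n m i) (minChord k n m j) =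
        if j = c i then negChord k n m i else 0)
    (huv : ∀ (i : Fin m) (j : Fin n),
      m₂ (minChord k n m j) (negChord k n m i) =
        if j = r i then negChord k n m i else 0)
    (hvv : ∀ i j : Fin m,
      m₂ (negChord k n m i) (negChord k n m j) ∈
        Submodule.span k {x | ∃ l : Fin m, max i j < l ∧ x = negChord k n m l})
    (α α' : Fin n → k) (κ κ' : Fin m → k)
    (hAB : m₂ (∑ i, α i • minChord k n m i + ∑ j, κ j • negChord k n m j)
             (∑ i, α' i • minChord k n m i + ∑ j, κ' j • negChord k n m j) =
           ∑ i, minChord k n m i) :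
    ∀ i : Fin n, α i * α' i = 1 ∧ α i ≠ 0 ∧ α' i ≠ 0 := by
  intro i
  have fst_negChord_product (a b : Fin m) :
      (m₂ (negChord k n m a) (negChord k n m b)).1 = 0 := by
    have span_le : Submodule.span k {x | ∃ l : Fin m, max a b < l ∧ x = negChord k n m l} ≤
        LinearMap.ker (LinearMap.fst k (Fin n → k) (Fin m → k)) := by
      rw [Submodule.span_le]
      rintro _ ⟨l, -, rfl⟩
      simp [negChord]
    simpa using span_le (hvv a b)
  have fst_negChord (b : Fin m) : (negChord k n m b).1 = 0 := rfl
  have coeff_eq := congrArg (fun x => x.1 i) hAB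
  simp only [map_add, map_sum, map_smul, LinearMap.add_apply, LinearMap.sum_apply,
    LinearMap.smul_apply, huu, hvu, huv, Prod.fst_add, Prod.fst_sum, Prod.smul_fst,
    Pi.add_apply, Finset.sum_apply, Pi.smul_apply, apply_ite Prod.fst, fst_negChord,
    fst_negChord_product] at coeff_eq
  have mul_eq_one : α i * α' i = 1 := by
    simpa [minChord, Pi.single_apply, ite_apply, mul_comm] using coeff_eq
  exact ⟨mul_eq_one, left_ne_zero_of_mul_eq_one mul_eq_one,
    right_ne_zero_of_mul_eq_one mul_eq_one⟩
end
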